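/- arXiv:2402.15669 — 3 statements merged into one kernel-verified Lean document; each statement's English description precedes it below -/
import Mathlib

section
/- Let n and k be integers with k ≥ 2 and n ≥ k+1, and let T be a tree with n vertices whose diameter is at least k. Then per L(T) ≥ per L(B(n,k)), with equality if and only if T is isomorphic to the broom graph B(n,k). -/
open scoped Classical

/-- Permanent of the Laplacian matrix of `G` (over `ℝ`). -/
noncomputable def permL {V : Type*} [Fintype V] (G : SimpleGraph V) : ℝ :=
  (G.lapMatrix ℝ).permanent

/-- The broom graph `B(n,k)`: a path on vertices `0, …, k-1` with `n-k` pendant edges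
attached at the endvertex `k-1`. -/
def broom (n k : ℕ) : SimpleGraph (Fin n) :=
  SimpleGraph.fromRel fun i j =>
    ((j : ℕ) = (i : ℕ) + 1 ∧ (j : ℕ) < k) ∨ ((i : ℕ) = k - 1 ∧ k ≤ (j : ℕ))

namespace Matrix

section Permanent

variable {m n R : Type*} [DecidableEq m] [Fintype m] [DecidableEq n] [Fintype n]

theorem permanent_submatrix_equiv_self [CommSemiring R] (e : n ≃ m) (A : Matrix m m R) :
    (A.submatrix e e).permanent = A.permanent := by
  unfold permanent
  refine Fintype.sum_equiv e.permCongr _ _ fun σ => ?_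
  exact Fintype.prod_equiv e _ _ fun i => by simp

/-- Expansion of a permanent along the column `none`. -/
theorem permanent_option [CommSemiring R] (M : Matrix (Option n) (Option n) R) :
    M.permanent = M none none * (M.submatrix some some).permanent +
      ∑ j, M (some j) none *
        ((M.submatrix some some).updateRow j fun x => M none (some x)).permanent := by
  unfold permanent
  rw [← Equiv.sum_comp Equiv.Perm.decomposeOption.symm, Fintype.sum_prod_type, Fintype.sum_option]
  simp only [Finset.mul_sum, Fintype.prod_option]
  congr 1
  refine Finset.sum_congr rfl fun j _ => Finset.sum_congr rfl fun τ _ => ?_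
  simp only [Equiv.Perm.decomposeOption_symm_apply, Equiv.Perm.coe_mul, Function.comp_apply,
    Equiv.optionCongr_apply, Option.map_none, Option.map_some, Equiv.swap_apply_left]
  congr 1
  refine Finset.prod_congr rfl fun x _ => ?_
  by_cases h : τ x = j
  · simp [h]
  · simp [h, Equiv.swap_apply_of_ne_of_ne]

theorem permanent_updateRow_add [CommSemiring R] (M : Matrix n n R) (j : n) (u v : n → R) :
    (M.updateRow j (u + v)).permanent =
      (M.updateRow j u).permanent + (M.updateRow j v).permanent := by
  unfold permanent
  rw [← Finset.sum_add_distrib]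
  refine Finset.sum_congr rfl fun σ _ => ?_
  simp only [← Finset.mul_prod_erase Finset.univ _ (Finset.mem_univ (σ.symm j)),
    Equiv.apply_symm_apply, updateRow_self, Pi.add_apply, add_mul]
  have key : ∀ w : n → R, ∏ x ∈ Finset.univ.erase (σ.symm j), M.updateRow j w (σ x) x =
      ∏ x ∈ Finset.univ.erase (σ.symm j), M (σ x) x := fun w =>
    Finset.prod_congr rfl fun x hx => by
      rw [updateRow_ne]
      rintro rfl
      simp at hx
  simp only [key]

theorem permanent_updateRow_zero [CommSemiring R] (M : Matrix n n R) (j : n) :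
    (M.updateRow j 0).permanent = 0 := by
  simpa using permanent_updateRow_smul M j 0 0

/-- The permanent of the matrix obtained by deleting the row and the column of `u`. -/
def permanentDel [CommSemiring R] (M : Matrix n n R) (u : n) : R :=
  (M.updateRow u (Pi.single u 1)).permanent

theorem permanentDel_none [CommSemiring R] (M : Matrix (Option n) (Option n) R) :
    M.permanentDel none = (M.submatrix some some).permanent := by
  unfold permanentDel
  rw [permanent_option]
  have h : (fun x : n => (M.updateRow none (Pi.single none 1) : Matrix _ _ R) none (some x)) =
      0 := by
    ext x
    simp
  rw [h]
  simp only [permanent_updateRow_zero, mul_zero, Finset.sum_const_zero, add_zero]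
  simp only [updateRow_self, Pi.single_eq_same, one_mul]
  congr 1

theorem permanent_add_single [CommSemiring R] (M : Matrix n n R) (u : n) :
    (M + single u u 1).permanent = M.permanent + M.permanentDel u := by
  have h : M + single u u 1 = M.updateRow u (M u + Pi.single u 1) := by
    ext i j
    by_cases hi : i = u
    · subst hi
      simp [single_apply, Pi.single_apply, eq_comm]
    · simp [hi, Ne.symm hi]
  rw [h, permanent_updateRow_add, updateRow_eq_self, permanentDel]

theorem permanent_option_of_leaf [CommSemiring R] (M : Matrix (Option n) (Option n) R) (u : n)
    (hcol : ∀ x, x ≠ u → M (some x) none = 0) (hrow : ∀ x, x ≠ u → M none (some x) = 0) :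
    M.permanent = M none none * (M.submatrix some some).permanent +
      M (some u) none * M none (some u) * (M.submatrix some some).permanentDel u := by
  rw [permanent_option, Finset.sum_eq_single u (fun x _ hx => by rw [hcol x hx, zero_mul])
    (by simp)]
  have h : (fun x => M none (some x)) = M none (some u) • (Pi.single u 1 : n → R) := by
    ext x
    by_cases hx : x = u
    · subst hx; simp
    · simp [hx, hrow x hx]
  rw [h, permanent_updateRow_smul, permanentDel, mul_assoc]

theorem permanent_mono {A B : Matrix n n ℝ} (hA : ∀ i j, 0 ≤ A i j) (hAB : ∀ i j, A i j ≤ B i j) :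
    A.permanent ≤ B.permanent :=
  Finset.sum_le_sum fun _ _ => Finset.prod_le_prod (fun _ _ => hA _ _) fun _ _ => hAB _ _

theorem permanent_strictMono {A B : Matrix n n ℝ} (hA : ∀ i j, 0 ≤ A i j)
    (hAB : ∀ i j, A i j ≤ B i j) (hdiag : ∀ i, 0 < A i i) {x : n} (hx : A x x < B x x) :
    A.permanent < B.permanent :=
  Finset.sum_lt_sum
    (fun _ _ => Finset.prod_le_prod (fun _ _ => hA _ _) fun _ _ => hAB _ _)
    ⟨1, Finset.mem_univ _, Finset.prod_lt_prod (fun i _ => hdiag i) (fun _ _ => hAB _ _)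
      ⟨x, Finset.mem_univ _, hx⟩⟩

theorem permanent_submatrix_le {A : Matrix n n ℝ} (hA : ∀ i j, 0 ≤ A i j)
    (hdiag : ∀ i, 1 ≤ A i i) (f : m ↪ n) : (A.submatrix f f).permanent ≤ A.permanent := by
  classical
  unfold permanent
  have hinj : Function.Injective fun σ : Equiv.Perm m => σ.viaFintypeEmbedding f := by
    intro σ τ h
    ext x
    have := congrArg (fun ρ : Equiv.Perm n => ρ (f x)) h
    simpa using this
  calc _ ≤ ∑ σ : Equiv.Perm m, ∏ i, A (σ.viaFintypeEmbedding f i) i := by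
        refine Finset.sum_le_sum fun σ _ => ?_
        rw [← Finset.prod_mul_prod_compl (Finset.univ.map f)
          fun i => A (σ.viaFintypeEmbedding f i) i, Finset.prod_map]
        simp only [Equiv.Perm.viaFintypeEmbedding_apply_image, submatrix_apply]
        refine le_mul_of_one_le_right (Finset.prod_nonneg fun _ _ => hA _ _) ?_
        refine Finset.one_le_prod fun i hi => ?_
        rw [Equiv.Perm.viaFintypeEmbedding_apply_notMem_range]
        · exact hdiag i
        · simpa using hi
    _ ≤ _ := by
        rw [← Finset.sum_image (f := fun σ : Equiv.Perm n => ∏ i, A (σ i) i) hinj.injOn]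
        exact Finset.sum_le_sum_of_subset_of_nonneg (Finset.subset_univ _)
          fun _ _ _ => Finset.prod_nonneg fun _ _ => hA _ _

theorem submatrix_finSuccEquivLast_symm_some (z : ℕ → ℕ → R) (m : ℕ) :
    (((of fun i j : Fin (m + 1) => z i j).submatrix finSuccEquivLast.symm
      finSuccEquivLast.symm).submatrix some some) = of fun i j : Fin m => z i j := by
  ext i j
  simp

/-- The permanent of the leading `m × m` block of an infinite matrix. -/
def leadingPermanent [CommSemiring R] (z : ℕ → ℕ → R) (m : ℕ) : R :=
  (of fun i j : Fin m => z i j).permanent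

variable [CommSemiring R] (z : ℕ → ℕ → R) (m : ℕ)

theorem leadingPermanent_zero : leadingPermanent z 0 = 1 := permanent_isEmpty

theorem leadingPermanent_succ : leadingPermanent z (m + 1) =
    ((of fun i j : Fin (m + 1) => z i j).submatrix finSuccEquivLast.symm
      finSuccEquivLast.symm).permanent :=
  (permanent_submatrix_equiv_self _ _).symm

theorem leadingPermanent_transpose :
    leadingPermanent (fun i j => z j i) m = leadingPermanent z m :=
  permanent_transpose (of fun i j : Fin m => z i j)

theorem leadingPermanent_succ_of_col (h : ∀ i < m, z i m = 0) :
    leadingPermanent z (m + 1) = z m m * leadingPermanent z m := by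
  rw [leadingPermanent_succ, permanent_option, submatrix_finSuccEquivLast_symm_some]
  simp only [submatrix_apply, finSuccEquivLast_symm_none, finSuccEquivLast_symm_some, of_apply,
    Fin.val_last, Fin.val_castSucc, h _ (Fin.is_lt _), zero_mul, Finset.sum_const_zero, add_zero]
  rfl

theorem leadingPermanent_succ_of_row (h : ∀ i < m, z m i = 0) :
    leadingPermanent z (m + 1) = z m m * leadingPermanent z m := by
  rw [← leadingPermanent_transpose z, ← leadingPermanent_transpose z]
  exact leadingPermanent_succ_of_col (fun i j => z j i) m h

theorem permanentDel_last :
    (of fun i j : Fin (m + 1) => z i j).permanentDel (Fin.last m) = leadingPermanent z m := by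
  have h := permanentDel_none ((of fun i j : Fin (m + 1) => z i j).submatrix finSuccEquivLast.symm
    finSuccEquivLast.symm)
  rw [submatrix_finSuccEquivLast_symm_some] at h
  rw [leadingPermanent, ← h, permanentDel, permanentDel,
    ← permanent_submatrix_equiv_self finSuccEquivLast.symm]
  congr 1
  ext i j
  cases i <;> cases j <;> simp [updateRow_apply]

theorem leadingPermanent_succ_succ (hcol : ∀ i < m, z i (m + 1) = 0)
    (hrow : ∀ i < m, z (m + 1) i = 0) :
    leadingPermanent z (m + 2) = z (m + 1) (m + 1) * leadingPermanent z (m + 1) +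
      z m (m + 1) * z (m + 1) m * leadingPermanent z m := by
  have hlt : ∀ x : Fin (m + 1), x ≠ Fin.last m → (x : ℕ) < m := fun x hx =>
    Fin.val_lt_last hx
  rw [leadingPermanent_succ, permanent_option_of_leaf _ (Fin.last m),
    submatrix_finSuccEquivLast_symm_some, permanentDel_last]
  · simp only [submatrix_apply, finSuccEquivLast_symm_none, finSuccEquivLast_symm_some, of_apply,
      Fin.val_last, Fin.val_castSucc]
    rfl
  · intro x hx
    simpa using hcol x (hlt x hx)
  · intro x hx
    simpa using hrow x (hlt x hx)

end Permanent

end Matrix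

/-- The numerators of the convergents of `√2`. -/
def halfPell : ℕ → ℝ
  | 0 => 1
  | 1 => 1
  | n + 2 => 2 * halfPell (n + 1) + halfPell n

/-- The Pell numbers, shifted so that they start with `1, 2`. -/
def pell : ℕ → ℝ
  | 0 => 1
  | 1 => 2
  | n + 2 => 2 * pell (n + 1) + pell n

theorem halfPell_succ_succ (n : ℕ) : halfPell (n + 2) = pell (n + 1) + pell n := by
  induction n using Nat.twoStepInduction with
  | zero => norm_num [halfPell, pell]
  | one => norm_num [halfPell, pell]
  | more n ih₁ ih₂ =>
    have h : pell (n + 2) = 2 * pell (n + 1) + pell n := rfl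
    have h' : pell (n + 3) = 2 * pell (n + 2) + pell (n + 1) := rfl
    rw [halfPell, ih₁, ih₂, h', h]
    ring

theorem one_le_halfPell (n : ℕ) : 1 ≤ halfPell n := by
  induction n using Nat.twoStepInduction with
  | zero => norm_num [halfPell]
  | one => norm_num [halfPell]
  | more n ih₁ ih₂ => rw [halfPell]; linarith

theorem halfPell_add_lt_mul (j m : ℕ) :
    halfPell (j + 2 + (m + 1)) < halfPell (j + 2) * halfPell (m + 2) := by
  induction j using Nat.twoStepInduction with
  | zero =>
    have := one_le_halfPell (m + 1)
    have := one_le_halfPell m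
    rw [show 0 + 2 + (m + 1) = m + 1 + 2 by ring]
    norm_num [halfPell]
    linarith
  | one =>
    have := one_le_halfPell (m + 1)
    have := one_le_halfPell m
    rw [show 1 + 2 + (m + 1) = m + 2 + 2 by ring]
    norm_num [halfPell]
    linarith
  | more j ih₁ ih₂ =>
    rw [show j + 2 + 2 + (m + 1) = j + 2 + (m + 1) + 2 by ring, halfPell, halfPell,
      show j + 2 + (m + 1) + 1 = j + 1 + 2 + (m + 1) by ring]
    have : halfPell (j + 1 + 2) = halfPell (j + 2 + 1) := rfl
    linarith

open Matrix

/-- The signless Laplacian of the path `0, …, k` with the vertex `j` isolated and given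
weight `1`. -/
def pathDel (k j a b : ℕ) : ℝ :=
  if a = b then if a = 0 ∨ a = k ∨ a = j then 1 else 2
  else if (b = a + 1 ∨ a = b + 1) ∧ a ≠ j ∧ b ≠ j then 1 else 0

theorem pathDel_nonneg (k j a b : ℕ) : 0 ≤ pathDel k j a b := by
  unfold pathDel
  split_ifs <;> norm_num

theorem leadingPermanent_pathDel (j m : ℕ) (hj : 1 ≤ j) :
    leadingPermanent (pathDel (j + m + 1) j) (j + m + 2) = halfPell j * halfPell (m + 1) := by
  set z := pathDel (j + m + 1) j with hz
  have hstep : ∀ l, leadingPermanent z (l + 2) =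
      z (l + 1) (l + 1) * leadingPermanent z (l + 1) +
        z l (l + 1) * z (l + 1) l * leadingPermanent z l := fun l =>
    leadingPermanent_succ_succ z l
      (fun i hi => by rw [hz, pathDel, if_neg (by omega), if_neg (by omega)])
      (fun i hi => by rw [hz, pathDel, if_neg (by omega), if_neg (by omega)])
  have hstart : ∀ l ≤ j, leadingPermanent z l = halfPell l := by
    intro l
    induction l using Nat.twoStepInduction with
    | zero => intro _; exact leadingPermanent_zero z
    | one =>
      intro _
      rw [leadingPermanent_succ_of_row z 0 (by simp), leadingPermanent_zero]
      simp [hz, pathDel, halfPell]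
    | more l ih₁ ih₂ =>
      intro hl
      rw [hstep, ih₁ (by omega), ih₂ (by omega), halfPell, hz, pathDel, pathDel, pathDel,
        if_pos rfl, if_neg (by omega), if_neg (by omega), if_pos (by omega), if_neg (by omega),
        if_pos (by omega)]
      ring
  have hmid : leadingPermanent z (j + 1) = halfPell j := by
    rw [leadingPermanent_succ_of_row z j, hstart j le_rfl]
    · simp [hz, pathDel]
    · intro i hi
      simp [hz, pathDel, hi.ne']
  have hmid' : z (j + 1) j = 0 := by simp [hz, pathDel]
  have hend : ∀ l ≤ m, leadingPermanent z (j + 1 + l) = halfPell j * pell l := by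
    intro l
    induction l using Nat.twoStepInduction with
    | zero => intro _; simp [hmid, pell]
    | one =>
      intro hl
      rw [hstep j, hmid, hmid', hz, pathDel, if_pos rfl, if_neg (by omega), pell]
      ring
    | more l ih₁ ih₂ =>
      intro hl
      rw [← Nat.add_assoc, hstep, ih₁ (by omega), Nat.add_assoc (j + 1), ih₂ (by omega), pell, hz,
        pathDel, pathDel, pathDel, if_pos rfl, if_neg (by omega), if_neg (by omega),
        if_pos (by omega), if_neg (by omega), if_pos (by omega)]
      ring
  cases m with
  | zero =>
    rw [hstep, hmid', hmid, hz, pathDel, if_pos rfl, if_pos (by omega), halfPell]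
    ring
  | succ m =>
    rw [hstep, show j + (m + 1) + 1 = j + 1 + (m + 1) by ring, hend _ le_rfl,
      show j + (m + 1) = j + 1 + m by ring, hend _ (by omega), halfPell_succ_succ, hz, pathDel,
      pathDel, pathDel, if_pos rfl, if_pos (by omega), if_neg (by omega), if_pos (by omega),
      if_neg (by omega), if_pos (by omega)]
    ring

/-- The signless Laplacian of the broom with handle `0, …, c`, after the row of the vertex `c`
has been replaced by a unit vector. -/
def broomDel (c a b : ℕ) : ℝ :=
  if a = c then if b = c then 1 else 0
  else if a = b then if a = 0 ∨ c < a then 1 else 2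
  else if ((b = a + 1 ∨ a = b + 1) ∧ a ≤ c ∧ b ≤ c) ∨ (c < a ∧ b = c) then 1 else 0

theorem leadingPermanent_broomDel (c l : ℕ) (hc : 1 ≤ c) :
    leadingPermanent (broomDel c) (c + 1 + l) = halfPell c := by
  set z := broomDel c with hz
  have hstart : ∀ l ≤ c, leadingPermanent z l = halfPell l := by
    intro l
    induction l using Nat.twoStepInduction with
    | zero => intro _; exact leadingPermanent_zero z
    | one =>
      intro _
      rw [leadingPermanent_succ_of_row z 0 (by simp), leadingPermanent_zero, hz, broomDel,
        if_neg (by omega)]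
      simp [halfPell]
    | more l ih₁ ih₂ =>
      intro hl
      rw [leadingPermanent_succ_succ z l
        (fun i hi => by rw [hz, broomDel, if_neg (by omega), if_neg (by omega), if_neg (by omega)])
        (fun i hi => by rw [hz, broomDel, if_neg (by omega), if_neg (by omega), if_neg (by omega)]),
        ih₁ (by omega), ih₂ (by omega), halfPell, hz, broomDel, broomDel, broomDel,
        if_neg (by omega), if_pos rfl, if_neg (by omega), if_neg (by omega), if_neg (by omega),
        if_pos (by omega), if_neg (by omega), if_neg (by omega), if_pos (by omega)]
      ring
  induction l with
  | zero =>
    rw [leadingPermanent_succ_of_row z c, hstart c le_rfl]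
    · simp [hz, broomDel]
    · intro i hi
      simp [hz, broomDel, hi.ne]
  | succ l ih =>
    rw [← Nat.add_assoc, leadingPermanent_succ_of_col z, ih, hz, broomDel, if_neg (by omega),
      if_pos rfl, if_pos (by omega), one_mul]
    intro i hi
    rw [hz, broomDel]
    by_cases h : i = c
    · rw [if_pos h, if_neg (by omega)]
    · rw [if_neg h, if_neg (by omega), if_neg (by omega)]

namespace SimpleGraph

variable {V W : Type*}

/-- The graph obtained from `H` by attaching a pendant vertex to `u`. -/
def addLeaf (H : SimpleGraph W) (u : W) : SimpleGraph (Option W) where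
  Adj
    | none, none => False
    | none, some x => x = u
    | some x, none => x = u
    | some x, some y => H.Adj x y
  symm := ⟨by rintro (_ | x) (_ | y) h <;> first | exact h | exact (id h : H.Adj _ _).symm⟩
  loopless := ⟨by rintro (_ | x) h <;> first | exact h | exact H.loopless.irrefl x h⟩

@[simp]
theorem addLeaf_adj_none_none (H : SimpleGraph W) (u : W) :
    ¬ (H.addLeaf u).Adj none none := id

@[simp]
theorem addLeaf_adj_none_some (H : SimpleGraph W) (u x : W) :
    (H.addLeaf u).Adj none (some x) ↔ x = u := Iff.rfl

@[simp]
theorem addLeaf_adj_some_none (H : SimpleGraph W) (u x : W) :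
    (H.addLeaf u).Adj (some x) none ↔ x = u := Iff.rfl

@[simp]
theorem addLeaf_adj_some_some (H : SimpleGraph W) (u x y : W) :
    (H.addLeaf u).Adj (some x) (some y) ↔ H.Adj x y := Iff.rfl

/-- The vertices `p 0, …, p k` form a path. -/
structure IsPathMap (T : SimpleGraph V) (k : ℕ) (p : ℕ → V) : Prop where
  adj : ∀ i < k, T.Adj (p i) (p (i + 1))
  inj : ∀ i ≤ k, ∀ j ≤ k, p i = p j → i = j

theorem IsTree.eq_of_adj_of_dist_eq {T : SimpleGraph V} (hT : T.IsTree) {r x y z : V}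
    (hy : T.Adj y x) (hz : T.Adj z x) (hyd : T.dist r x = T.dist r y + 1)
    (hzd : T.dist r x = T.dist r z + 1) : y = z := by
  obtain ⟨py, hpy⟩ := hT.connected.exists_walk_length_eq_dist r y
  obtain ⟨pz, hpz⟩ := hT.connected.exists_walk_length_eq_dist r z
  have h₁ : (py.concat hy).IsPath := Walk.isPath_of_length_eq_dist _ (by simp [hpy, hyd])
  have h₂ : (pz.concat hz).IsPath := Walk.isPath_of_length_eq_dist _ (by simp [hpz, hzd])
  have := (hT.existsUnique_path r x).unique h₁ h₂
  simpa using congrArg Walk.penultimate this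

theorem IsTree.dist_pathMap {T : SimpleGraph V} (hT : T.IsTree) {k : ℕ} {p : ℕ → V}
    (hp : T.IsPathMap k p) (i : ℕ) (hi : i ≤ k) : T.dist (p 0) (p i) = i := by
  induction i using Nat.twoStepInduction with
  | zero => simp
  | one => exact dist_eq_one_iff_adj.2 (hp.adj 0 (by omega))
  | more i ih₁ ih₂ =>
    rcases hT.dist_eq_dist_add_one_of_adj (p 0) (hp.adj (i + 1) (by omega)) with h | h
    · have := hT.eq_of_adj_of_dist_eq (r := p 0) (hp.adj i (by omega))
        (hp.adj (i + 1) (by omega)).symm (by rw [ih₁ (by omega), ih₂ (by omega)]) h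
      have := hp.inj _ (by omega) _ (by omega) this
      omega
    · rw [h, ih₂ (by omega)]

theorem Connected.exists_adj_of_nontrivial {T : SimpleGraph V} (hT : T.Connected) [Nontrivial V]
    (v : V) : ∃ w, T.Adj v w := by
  obtain ⟨w, hw⟩ := exists_ne v
  obtain ⟨q⟩ := hT.preconnected v w
  cases q with
  | nil => exact absurd rfl hw
  | cons h _ => exact ⟨_, h⟩

theorem IsPathMap.reverse {T : SimpleGraph V} {k : ℕ} {p : ℕ → V} (hp : T.IsPathMap k p) :
    T.IsPathMap k fun i => p (k - i) where
  adj i hi := by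
    have := hp.adj (k - (i + 1)) (by omega)
    rw [show k - (i + 1) + 1 = k - i by omega] at this
    exact this.symm
  inj i hi j hj h := by
    have := hp.inj _ (by omega) _ (by omega) h
    omega

theorem IsPathMap.injective {T : SimpleGraph V} {k : ℕ} {p : ℕ → V} (hp : T.IsPathMap k p) :
    Function.Injective fun i : Fin (k + 1) => p i := fun i j h =>
  Fin.ext (hp.inj i (by omega) j (by omega) h)

/-- All vertices outside of the path `p 0, …, p k` are adjacent to one and the same neighbor of an
end of the path. -/
def IsBroomAlong (T : SimpleGraph V) (k : ℕ) (p : ℕ → V) : Prop :=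
  (∀ x, (∀ i ≤ k, p i ≠ x) → T.Adj (p (k - 1)) x) ∨ (∀ x, (∀ i ≤ k, p i ≠ x) → T.Adj (p 1) x)

/-- Attaching a leaf to the vertex at which the bound for `permQDel` is attained. -/
theorem IsBroomAlong.of_induce {T : SimpleGraph V} {k : ℕ} {p : ℕ → V} {v u : V}
    (huv : T.Adj u v) {q : ℕ → {x | x ≠ v}} (hqp : ∀ i ≤ k, (q i : V) = p i) (hk : 2 ≤ k)
    (h : (T.induce {x | x ≠ v}).IsBroomAlong k q)
    (hu : (u = q 1 ∧ (3 ≤ k → ∀ x, (T.induce {x | x ≠ v}).Adj (q (k - 1)) x → ∃ l ≤ k, q l = x)) ∨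
      (u = q (k - 1) ∧ (3 ≤ k → ∀ x, (T.induce {x | x ≠ v}).Adj (q 1) x → ∃ l ≤ k, q l = x))) :
    T.IsBroomAlong k p := by
  have lift : ∀ j ≤ k, u = q j →
      (∀ x, (∀ i ≤ k, q i ≠ x) → (T.induce {x | x ≠ v}).Adj (q j) x) →
      ∀ x, (∀ i ≤ k, p i ≠ x) → T.Adj (p j) x := by
    intro j hj huj hall x hx
    rw [← hqp j hj]
    by_cases hxv : x = v
    · rw [hxv, ← huj]
      exact huv
    · exact hall ⟨x, hxv⟩ fun i hi hix => hx i hi (by rw [← hqp i hi, hix])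
  have vac : ∀ j m, (∀ x, (T.induce {x | x ≠ v}).Adj (q m) x → ∃ l ≤ k, q l = x) →
      (∀ x, (∀ i ≤ k, q i ≠ x) → (T.induce {x | x ≠ v}).Adj (q m) x) →
      ∀ x, (∀ i ≤ k, q i ≠ x) → (T.induce {x | x ≠ v}).Adj (q j) x := by
    intro j m hm hall x hx
    obtain ⟨l, hl, hlx⟩ := hm x (hall x hx)
    exact absurd hlx (hx l hl)
  rcases hk.eq_or_lt with rfl | hk3
  · have hu1 : u = q 1 := by rcases hu with hu | hu <;> exact hu.1
    have h1 : ∀ x, (∀ i ≤ 2, q i ≠ x) → (T.induce {x | x ≠ v}).Adj (q 1) x := by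
      rcases h with h | h <;> exact h
    exact .inr (lift 1 (by omega) hu1 h1)
  · rcases hu with ⟨hu, hm⟩ | ⟨hu, hm⟩
    · refine .inr (lift 1 (by omega) hu ?_)
      rcases h with h | h
      · exact vac 1 (k - 1) (hm hk3) h
      · exact h
    · refine .inl (lift (k - 1) (by omega) hu ?_)
      rcases h with h | h
      · exact h
      · exact vac (k - 1) 1 (hm hk3) h

theorem Walk.IsPath.isPathMap_getVert {T : SimpleGraph V} {u v : V} {w : T.Walk u v}
    (hw : w.IsPath) {k : ℕ} (hk : k ≤ w.length) : T.IsPathMap k w.getVert :=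
  ⟨fun _ hi => w.adj_getVert_succ (by omega),
    fun i hi j hj h => hw.getVert_injOn (hi.trans hk) (hj.trans hk) h⟩

variable [Fintype V] [Fintype W]

/-- The signless Laplacian matrix `D + A`. -/
noncomputable def signlessLap (T : SimpleGraph V) : Matrix V V ℝ := of fun i j =>
  if i = j then ∑ x, if T.Adj i x then 1 else 0 else if T.Adj i j then 1 else 0

/-- Permanent of the signless Laplacian matrix. -/
noncomputable def permQ (T : SimpleGraph V) : ℝ := T.signlessLap.permanent

/-- Permanent of the signless Laplacian matrix with the row and column of `u` deleted. -/
noncomputable def permQDel (T : SimpleGraph V) (u : V) : ℝ := T.signlessLap.permanentDel u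

theorem signlessLap_apply_self (T : SimpleGraph V) (i : V) :
    T.signlessLap i i = ∑ x, if T.Adj i x then 1 else 0 := by
  simp [signlessLap]

theorem signlessLap_apply_of_adj {T : SimpleGraph V} {i j : V} (h : T.Adj i j) :
    T.signlessLap i j = 1 := by
  simp [signlessLap, h, h.ne]

theorem signlessLap_nonneg (T : SimpleGraph V) (i j : V) : 0 ≤ T.signlessLap i j := by
  simp only [signlessLap, of_apply]
  split_ifs
  · exact Finset.sum_nonneg fun x _ => by split_ifs <;> norm_num
  · norm_num
  · norm_num

theorem card_le_signlessLap {T : SimpleGraph V} {i : V} (s : Finset V) (h : ∀ x ∈ s, T.Adj i x) :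
    (s.card : ℝ) ≤ T.signlessLap i i := by
  rw [signlessLap_apply_self, Finset.sum_boole]
  exact_mod_cast Finset.card_le_card fun x hx => by simpa using h x hx

theorem permQDel_eq_permanent {T : SimpleGraph V} {u : V} {N : Matrix V V ℝ} (huu : N u u = 1)
    (hu : ∀ x, x ≠ u → N u x = 0) (h : ∀ x, x ≠ u → ∀ y, T.signlessLap x y = N x y) :
    T.permQDel u = N.permanent := by
  unfold permQDel permanentDel
  congr 1
  ext x y
  rw [updateRow_apply, Pi.single_apply]
  split_ifs with hx hy
  · rw [hx, hy, huu]
  · rw [hx, hu y hy]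
  · exact h x hx y

theorem permL_eq_permQ {T : SimpleGraph V} (h : T.Colorable 2) : permL T = T.permQ := by
  obtain ⟨c⟩ := h
  let s : V → ℝ := fun v => if c v = 0 then 1 else -1
  have hs : ∀ v, s v * s v = 1 := fun v => by simp only [s]; split_ifs <;> norm_num
  have hL : ∀ i j, T.lapMatrix ℝ i j = s i * s j * T.signlessLap i j := by
    intro i j
    by_cases hij : i = j
    · subst hij
      rw [hs, one_mul, signlessLap_apply_self, ← degree_eq_sum_if_adj]
      simp [lapMatrix, degMatrix]
    · by_cases hadj : T.Adj i j
      · rw [signlessLap_apply_of_adj hadj]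
        have hc := c.valid hadj
        have : s i * s j = -1 := by
          simp only [s]
          split_ifs with h₁ h₂ h₂
          · exact absurd (h₁.trans h₂.symm) hc
          · norm_num
          · norm_num
          · exact absurd (by omega) hc
        rw [this]
        simp [lapMatrix, degMatrix, hij, hadj]
      · simp [lapMatrix, degMatrix, signlessLap, hij, hadj]
  unfold permL permQ permanent
  refine Finset.sum_congr rfl fun σ _ => ?_
  simp only [hL, Finset.prod_mul_distrib]
  rw [Equiv.prod_comp σ s, ← Finset.prod_mul_distrib]
  simp [hs]

theorem permQ_congr {T : SimpleGraph V} {T' : SimpleGraph W} (e : T ≃g T') :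
    T.permQ = T'.permQ := by
  rw [permQ, permQ, ← permanent_submatrix_equiv_self e.toEquiv]
  congr 1
  ext i j
  by_cases hij : i = j
  · subst hij
    rw [submatrix_apply, signlessLap_apply_self, signlessLap_apply_self,
      ← Equiv.sum_comp e.toEquiv]
    refine Finset.sum_congr rfl fun x _ => ?_
    exact if_congr e.map_adj_iff.symm rfl rfl
  · simp [signlessLap, hij, e.map_adj_iff]

theorem permQ_addLeaf (H : SimpleGraph W) (u : W) :
    (H.addLeaf u).permQ = H.permQ + 2 * H.permQDel u := by
  have hnone : (H.addLeaf u).signlessLap none none = 1 := by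
    rw [signlessLap_apply_self, Fintype.sum_option]
    simp
  have hrow : ∀ x, (H.addLeaf u).signlessLap none (some x) = if x = u then 1 else 0 := by
    simp [signlessLap]
  have hcol : ∀ x, (H.addLeaf u).signlessLap (some x) none = if x = u then 1 else 0 := by
    simp [signlessLap]
  have hsub : (H.addLeaf u).signlessLap.submatrix some some =
      H.signlessLap + Matrix.single u u 1 := by
    ext x y
    by_cases hxy : x = y
    · subst hxy
      rw [submatrix_apply, Matrix.add_apply, signlessLap_apply_self, signlessLap_apply_self,
        Fintype.sum_option, add_comm]
      simp [Matrix.single_apply, eq_comm]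
    · have : ¬ (u = x ∧ u = y) := fun h => hxy (h.1.symm.trans h.2)
      simp [signlessLap, hxy, this]
  have hdel : (H.signlessLap + Matrix.single u u 1).permanentDel u =
      H.signlessLap.permanentDel u := by
    rw [permanentDel, permanentDel]
    congr 1
    ext x y
    by_cases hx : x = u
    · simp [hx]
    · simp [hx, Ne.symm hx]
  have h := permanent_option_of_leaf (H.addLeaf u).signlessLap u
    (fun x hx => by rw [hcol, if_neg hx]) (fun x hx => by rw [hrow, if_neg hx])
  rw [hsub, hdel, permanent_add_single, hnone, hrow, hcol, if_pos rfl] at h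
  rw [permQ, permQ, permQDel]
  convert h using 1
  · congr!
  · ring

theorem IsPathMap.card_add_two_le {T : SimpleGraph V} {k : ℕ} {p : ℕ → V} (hp : T.IsPathMap k p)
    {i : ℕ} (hi : 1 ≤ i) (hik : i < k) (s : Finset V)
    (hs : ∀ x ∈ s, T.Adj (p i) x ∧ ∀ l ≤ k, p l ≠ x) :
    (s.card + 2 : ℝ) ≤ T.signlessLap (p i) (p i) := by
  have hne : p (i - 1) ≠ p (i + 1) := fun h => by
    have := hp.inj _ (by omega) _ (by omega) h
    omega
  have h := card_le_signlessLap (T := T) (i := p i) (insert (p (i - 1)) (insert (p (i + 1)) s))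
    (by
      simp only [Finset.mem_insert]
      rintro x (rfl | rfl | hx)
      · have := hp.adj (i - 1) (by omega)
        rw [Nat.sub_add_cancel hi] at this
        exact this.symm
      · exact hp.adj i hik
      · exact (hs x hx).1)
  rw [Finset.card_insert_of_notMem, Finset.card_insert_of_notMem] at h
  · push_cast at h
    linarith
  · exact fun hx => (hs _ hx).2 (i + 1) (by omega) rfl
  · rw [Finset.mem_insert, not_or]
    exact ⟨hne, fun hx => (hs _ hx).2 (i - 1) (by omega) rfl⟩

theorem IsPathMap.pathDel_le {T : SimpleGraph V} {k : ℕ} {p : ℕ → V} (hp : T.IsPathMap k p)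
    (hT : ∀ v, ∃ w, T.Adj v w) {u : V} {j : ℕ} (hj : 1 ≤ j) (hjk : j < k)
    (hu : ∀ i ≤ k, p i = u → i = j ∨ (i = 0 ∧ j = 1) ∨ (i = k ∧ j + 1 = k))
    (a b : ℕ) (ha : a ≤ k) (hb : b ≤ k) :
    pathDel k j a b ≤ T.signlessLap.updateRow u (Pi.single u 1) (p a) (p b) := by
  have hone : ∀ v, 1 ≤ T.signlessLap v v := fun v => by
    obtain ⟨w, hw⟩ := hT v
    simpa using card_le_signlessLap (T := T) (i := v) {w} (by simpa using hw)
  by_cases hab : a = b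
  · subst hab
    by_cases hau : p a = u
    · have := hu a ha hau
      rw [hau, updateRow_self, Pi.single_eq_same, pathDel, if_pos rfl, if_pos (by omega)]
    · rw [updateRow_ne hau, pathDel, if_pos rfl]
      split_ifs with h
      · exact hone _
      · simpa using hp.card_add_two_le (i := a) (by omega) (by omega) ∅ (by simp)
  · rw [pathDel, if_neg hab]
    split_ifs with h
    · have hau : p a ≠ u := fun hau => by
        have := hu a ha hau
        omega
      rw [updateRow_ne hau, signlessLap_apply_of_adj]
      rcases h.1 with rfl | rfl
      · exact hp.adj _ (by omega)
      · exact (hp.adj _ (by omega)).symm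
    · rw [updateRow_apply]
      split_ifs with hau
      · rw [Pi.single_apply]
        split_ifs <;> norm_num
      · exact signlessLap_nonneg _ _ _

theorem IsPathMap.le_permQDel {T : SimpleGraph V} {k : ℕ} {p : ℕ → V} (hp : T.IsPathMap k p)
    (hT : ∀ v, ∃ w, T.Adj v w) {u : V} {j : ℕ} (hj : 1 ≤ j) (hjk : j < k)
    (hu : ∀ i ≤ k, p i = u → i = j ∨ (i = 0 ∧ j = 1) ∨ (i = k ∧ j + 1 = k)) :
    halfPell j * halfPell (k - j) ≤ T.permQDel u ∧
      ((∃ x ≤ k, p x ≠ u ∧ pathDel k j x x < T.signlessLap (p x) (p x)) →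
        halfPell j * halfPell (k - j) < T.permQDel u) := by
  obtain ⟨m, rfl⟩ : ∃ m, k = j + m + 1 := ⟨k - j - 1, by omega⟩
  rw [show j + m + 1 - j = m + 1 by omega, ← leadingPermanent_pathDel j m hj]
  set A : Matrix V V ℝ := T.signlessLap.updateRow u (Pi.single u 1) with hA
  have hAnn : ∀ x y, 0 ≤ A x y := fun x y => by
    rw [hA, updateRow_apply]
    split_ifs
    · rw [Pi.single_apply]
      split_ifs <;> norm_num
    · exact signlessLap_nonneg _ _ _
  have hAd : ∀ x, 1 ≤ A x x := fun x => by
    by_cases hx : x = u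
    · rw [hx, hA, updateRow_self, Pi.single_eq_same]
    · obtain ⟨w, hw⟩ := hT x
      rw [hA, updateRow_ne hx]
      simpa using card_le_signlessLap (T := T) (i := x) {w} (by simpa using hw)
  let f : Fin (j + m + 2) ↪ V := ⟨fun i => p i, fun a b h => Fin.ext
    (hp.inj a (by omega) b (by omega) h)⟩
  have hle : (A.submatrix f f).permanent ≤ T.permQDel u := permanent_submatrix_le hAnn hAd f
  have hent : ∀ a b : Fin (j + m + 2), pathDel (j + m + 1) j a b ≤ A.submatrix f f a b :=
    fun a b => hp.pathDel_le hT hj hjk hu a b (by omega) (by omega)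
  refine ⟨(permanent_mono (fun a b => pathDel_nonneg _ _ _ _) hent).trans hle, ?_⟩
  rintro ⟨x, hxk, hxu, hx⟩
  refine (permanent_strictMono (fun a b => pathDel_nonneg _ _ _ _) hent (fun a => ?_)
    (x := ⟨x, by omega⟩) ?_).trans_le hle
  · simp only [pathDel, if_true]
    split_ifs <;> norm_num
  · have : A (p x) (p x) = T.signlessLap (p x) (p x) := by rw [hA, updateRow_ne hxu]
    exact hx.trans_eq this.symm

theorem IsPathMap.halfPell_le_permQDel {T : SimpleGraph V} {k : ℕ} {p : ℕ → V}
    (hp : T.IsPathMap k p) (hT : ∀ v, ∃ w, T.Adj v w) (hk : 2 ≤ k) (u : V) :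
    halfPell (k - 1) ≤ T.permQDel u ∧ (T.permQDel u = halfPell (k - 1) →
      (u = p 1 ∧ (3 ≤ k → ∀ x, T.Adj (p (k - 1)) x → ∃ l ≤ k, p l = x)) ∨
      (u = p (k - 1) ∧ (3 ≤ k → ∀ x, T.Adj (p 1) x → ∃ l ≤ k, p l = x))) := by
  have hinner : ∀ i, 1 ≤ i → i < k → (2 : ℝ) ≤ T.signlessLap (p i) (p i) := fun i hi hik => by
    simpa using hp.card_add_two_le hi hik ∅ (by simp)
  have hextra : ∀ i x, 1 ≤ i → i < k → T.Adj (p i) x → (∀ l ≤ k, p l ≠ x) →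
      (2 : ℝ) < T.signlessLap (p i) (p i) := fun i x hi hik hx hxl => by
    have := hp.card_add_two_le hi hik {x} (by simpa using ⟨hx, hxl⟩)
    norm_num at this
    linarith
  have hfirst : halfPell 1 * halfPell (k - 1) = halfPell (k - 1) := by simp [halfPell]
  have hlast : halfPell (k - 1) * halfPell (k - (k - 1)) = halfPell (k - 1) := by
    rw [show k - (k - 1) = 1 by omega, mul_comm, hfirst]
  by_cases hmem : ∃ i, 1 ≤ i ∧ i ≤ k ∧ p i = u
  · obtain ⟨i, hi, hik, rfl⟩ := hmem
    have huniq : ∀ l ≤ k, p l = p i → l = i := fun l hl h => hp.inj l hl i hik h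
    by_cases h1 : i = 1
    · subst h1
      obtain ⟨hle, hlt⟩ := hp.le_permQDel hT le_rfl (by omega) (u := p 1)
        fun l hl h => .inl (huniq l hl h)
      rw [hfirst] at hle hlt
      refine ⟨hle, fun heq => .inl ⟨rfl, fun hk3 x hx => ?_⟩⟩
      by_contra! hxl
      refine (hlt ⟨k - 1, by omega, fun h => ?_, ?_⟩).ne' heq
      · have := huniq _ (by omega) h
        omega
      · rw [pathDel, if_pos rfl, if_neg (by omega)]
        exact hextra _ x (by omega) (by omega) hx hxl
    by_cases h2 : i = k - 1
    · subst h2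
      obtain ⟨hle, hlt⟩ := hp.le_permQDel hT hi (by omega) (u := p (k - 1))
        fun l hl h => .inl (huniq l hl h)
      rw [hlast] at hle hlt
      refine ⟨hle, fun heq => .inr ⟨rfl, fun hk3 x hx => ?_⟩⟩
      by_contra! hxl
      refine (hlt ⟨1, by omega, fun h => ?_, ?_⟩).ne' heq
      · have := huniq _ (by omega) h
        omega
      · rw [pathDel, if_pos rfl, if_neg (by omega)]
        exact hextra _ x (by omega) (by omega) hx hxl
    suffices h : halfPell (k - 1) < T.permQDel (p i) from ⟨h.le, fun heq => absurd heq h.ne'⟩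
    by_cases h3 : i = k
    · subst h3
      obtain ⟨-, hlt⟩ := hp.le_permQDel hT (j := i - 1) (by omega) (by omega) (u := p i)
        fun l hl h => by have := huniq l hl h; omega
      rw [hlast] at hlt
      refine hlt ⟨i - 1, by omega, fun h => ?_, ?_⟩
      · have := huniq _ (by omega) h
        omega
      · rw [pathDel, if_pos rfl, if_pos (by omega)]
        linarith [hinner (i - 1) (by omega) (by omega)]
    · obtain ⟨hle, -⟩ := hp.le_permQDel hT hi (by omega) (u := p i)
        fun l hl h => .inl (huniq l hl h)
      refine lt_of_lt_of_le ?_ hle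
      have := halfPell_add_lt_mul (i - 2) (k - i - 2)
      rwa [show i - 2 + 2 + (k - i - 2 + 1) = k - 1 by omega, show i - 2 + 2 = i by omega,
        show k - i - 2 + 2 = k - i by omega] at this
  · push Not at hmem
    suffices h : halfPell (k - 1) < T.permQDel u from ⟨h.le, fun heq => absurd heq h.ne'⟩
    obtain ⟨-, hlt⟩ := hp.le_permQDel hT (j := 1) le_rfl (by omega) (u := u)
      fun l hl h => by
        by_cases h0 : l = 0
        · exact .inr (.inl ⟨h0, rfl⟩)
        · exact absurd h (hmem l (by omega) hl)
    rw [hfirst] at hlt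
    refine hlt ⟨1, by omega, hmem 1 le_rfl (by omega), ?_⟩
    rw [pathDel, if_pos rfl, if_pos (by omega)]
    linarith [hinner 1 (by omega) (by omega)]

/-- A tree that is larger than a given path has a leaf outside of the path. -/
theorem IsTree.exists_leaf_notMem_path {T : SimpleGraph V} (hT : T.IsTree) {k : ℕ} {p : ℕ → V}
    (hp : T.IsPathMap k p) (hx : ∃ x, ∀ i ≤ k, p i ≠ x) :
    ∃ v u, (∀ i ≤ k, p i ≠ v) ∧ ∀ w, T.Adj v w ↔ w = u := by
  obtain ⟨v, hv, hmax⟩ := Finset.exists_max_image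
    (Finset.univ.filter fun x => ∀ i ≤ k, p i ≠ x) (T.dist (p 0))
    (by simpa [Finset.Nonempty] using hx)
  simp only [Finset.mem_filter, Finset.mem_univ, true_and] at hv hmax
  have hparent : ∀ w, T.Adj v w → T.dist (p 0) v = T.dist (p 0) w + 1 := by
    intro w hw
    refine (hT.dist_eq_dist_add_one_of_adj (p 0) hw).resolve_right fun h => ?_
    by_cases hwp : ∀ i ≤ k, p i ≠ w
    · have := hmax w hwp
      omega
    · push Not at hwp
      obtain ⟨i, hi, rfl⟩ := hwp
      rw [hT.dist_pathMap hp i hi] at h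
      refine hv (i - 1) (by omega) (hT.eq_of_adj_of_dist_eq (r := p 0) ?_ hw ?_ ?_)
      · have := hp.adj (i - 1) (by omega)
        rwa [Nat.sub_add_cancel (by omega)] at this
      · rw [hT.dist_pathMap hp i hi, hT.dist_pathMap hp _ (by omega)]
        omega
      · rw [hT.dist_pathMap hp i hi, h]
  obtain ⟨u, hu⟩ : ∃ u, T.Adj v u := by
    obtain ⟨w, hw⟩ := hT.connected.exists_walk_length_eq_dist v (p 0)
    cases w with
    | nil => exact absurd rfl (hv 0 (by omega))
    | cons h _ => exact ⟨_, h⟩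
  refine ⟨v, u, hv, fun w => ⟨fun hw => ?_, fun h => h ▸ hu⟩⟩
  exact hT.eq_of_adj_of_dist_eq hw.symm hu.symm (hparent w hw) (hparent u hu)

/-- Removing a leaf from a tree. -/
theorem IsTree.induce_compl_leaf {T : SimpleGraph V} (hT : T.IsTree) {v u : V}
    (hv : ∀ w, T.Adj v w ↔ w = u) : (T.induce {x | x ≠ v}).IsTree := by
  refine ⟨?_, hT.isAcyclic.induce _⟩
  refine hT.connected.induce_compl_singleton_of_degree_eq_one (v := v) ?_
  rw [degree_eq_one_iff_existsUnique_adj]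
  exact ⟨u, (hv u).2 rfl, fun w hw => (hv w).1 hw⟩

/-- A graph with a leaf is obtained by attaching the leaf to the graph without it. -/
noncomputable def isoAddLeaf (T : SimpleGraph V) {v u : V} (huv : u ≠ v)
    (hv : ∀ w, T.Adj v w ↔ w = u) : (T.induce {x | x ≠ v}).addLeaf ⟨u, huv⟩ ≃g T where
  toEquiv := Equiv.optionSubtypeNe v
  map_rel_iff' := by
    have hsome : ∀ x : {x | x ≠ v}, Equiv.optionSubtypeNe v (some x) = x :=
      Equiv.optionSubtypeNe_some v
    have hnone : Equiv.optionSubtypeNe v none = v := Equiv.optionSubtypeNe_none v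
    rintro (_ | x) (_ | y)
    · simp
    · rw [hsome, hnone, hv, addLeaf_adj_none_some, Subtype.ext_iff]
    · rw [hsome, hnone, T.adj_comm, hv, addLeaf_adj_some_none, Subtype.ext_iff]
    · rw [hsome, hsome, addLeaf_adj_some_some, comap_adj]
      rfl

theorem broom_adj {n k : ℕ} {i j : Fin n} : (broom n k).Adj i j ↔ i ≠ j ∧
    ((((j : ℕ) = i + 1 ∧ (j : ℕ) < k) ∨ ((i : ℕ) = k - 1 ∧ k ≤ (j : ℕ))) ∨
      (((i : ℕ) = j + 1 ∧ (i : ℕ) < k) ∨ ((j : ℕ) = k - 1 ∧ k ≤ (i : ℕ)))) :=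
  fromRel_adj _ _ _

theorem broom_colorable {n k : ℕ} (hk : 1 ≤ k) : (broom n k).Colorable 2 := by
  refine ⟨Coloring.mk (fun i => ⟨min (i : ℕ) k % 2, by omega⟩) fun {i j} h => ?_⟩
  rw [broom_adj] at h
  rw [Ne, Fin.mk.injEq]
  omega

theorem broom_connected {n k : ℕ} (hk : 1 ≤ k) (hn : k ≤ n) : (broom n k).Connected := by
  rw [connected_iff_exists_forall_reachable]
  refine ⟨⟨0, by omega⟩, ?_⟩
  suffices h : ∀ (m : ℕ) (hm : m < n), (broom n k).Reachable ⟨0, by omega⟩ ⟨m, hm⟩ from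
    fun i => h i i.2
  intro m
  induction m using Nat.strong_induction_on with
  | _ m ih =>
    intro hm
    by_cases h0 : m = 0
    · subst h0
      exact Reachable.refl _
    · refine (ih (min (m - 1) (k - 1)) (by omega) (by omega)).trans (Adj.reachable ?_)
      rw [broom_adj, Ne, Fin.mk.injEq]
      dsimp only
      omega

/-- A broom with one more bristle. -/
def broomIsoAddLeaf {n k : ℕ} (hk : 1 ≤ k) (hn : k ≤ n) :
    (broom n k).addLeaf ⟨k - 1, by omega⟩ ≃g broom (n + 1) k where
  toEquiv := finSuccEquivLast.symm
  map_rel_iff' := by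
    rintro (_ | x) (_ | y)
    · simp
    all_goals
      simp only [finSuccEquivLast_symm_none, finSuccEquivLast_symm_some, addLeaf_adj_none_some,
        addLeaf_adj_some_none, addLeaf_adj_some_some, broom_adj, Fin.ext_iff, Fin.val_last,
        Fin.val_castSucc, ne_eq] <;>
      omega

theorem broom_signlessLap_apply {n k : ℕ} (hk : 2 ≤ k) (hn : k ≤ n) (i j : Fin n)
    (hi : (i : ℕ) ≠ k - 1) : (broom n k).signlessLap i j = broomDel (k - 1) i j := by
  by_cases hij : i = j
  · subst hij
    rw [signlessLap_apply_self, Finset.sum_boole, broomDel, if_neg hi, if_pos rfl]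
    split_ifs with h
    · have : (Finset.univ.filter fun x => (broom n k).Adj i x) =
          {⟨if (i : ℕ) = 0 then 1 else k - 1, by split_ifs <;> omega⟩} := by
        ext x
        simp only [Finset.mem_filter, Finset.mem_univ, true_and, Finset.mem_singleton, broom_adj,
          Fin.ext_iff, ne_eq]
        split_ifs <;> omega
      rw [this]
      simp
    · have : (Finset.univ.filter fun x => (broom n k).Adj i x) =
          {⟨i - 1, by omega⟩, ⟨i + 1, by omega⟩} := by
        ext x
        simp only [Finset.mem_filter, Finset.mem_univ, true_and, Finset.mem_insert,
          Finset.mem_singleton, broom_adj, Fin.ext_iff, ne_eq]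
        omega
      rw [this, Finset.card_pair]
      · norm_num
      · rw [Ne, Fin.mk.injEq]
        omega
  · have hij' : (i : ℕ) ≠ j := fun h => hij (Fin.ext h)
    rw [broomDel, if_neg hi, if_neg hij']
    simp only [signlessLap, of_apply, if_neg hij]
    refine if_congr ?_ rfl rfl
    rw [broom_adj]
    omega

theorem permQDel_broom {n k : ℕ} (hk : 2 ≤ k) (hn : k ≤ n) :
    (broom n k).permQDel ⟨k - 1, by omega⟩ = halfPell (k - 1) := by
  rw [permQDel_eq_permanent (N := of fun i j : Fin n => broomDel (k - 1) i j),
    ← leadingPermanent_broomDel (k - 1) (n - k) (by omega), show k - 1 + 1 + (n - k) = n by omega,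
    leadingPermanent]
  · congr!
  · simp [broomDel]
  · intro j hj
    have : (j : ℕ) ≠ k - 1 := fun h => hj (Fin.ext h)
    simp [broomDel, this]
  · exact fun i hi j => broom_signlessLap_apply hk hn i j fun h => hi (Fin.ext h)

theorem permQ_broom_succ {n k : ℕ} (hk : 2 ≤ k) (hn : k ≤ n) :
    (broom (n + 1) k).permQ = (broom n k).permQ + 2 * halfPell (k - 1) := by
  rw [← permQ_congr (broomIsoAddLeaf (by omega) hn), permQ_addLeaf, permQDel_broom hk hn]

theorem IsTree.nonempty_iso_broom {T : SimpleGraph V} (hT : T.IsTree) {n k : ℕ} (hk : 1 ≤ k)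
    (hn : k + 1 ≤ n) (hV : Fintype.card V = n) {p : ℕ → V} (hp : T.IsPathMap k p)
    (h : ∀ x, (∀ i ≤ k, p i ≠ x) → T.Adj (p (k - 1)) x) : Nonempty (T ≃g broom n k) := by
  obtain ⟨g, hg⟩ := Finset.exists_equiv_extend_of_card_eq (α := Fin n)
    (t := (Finset.univ : Finset V)) (by simp [hV])
    (s := Finset.univ.filter fun i : Fin n => (i : ℕ) ≤ k) (f := fun i => p i)
    (Finset.subset_univ _) (fun i hi j hj hij => Fin.ext (hp.inj i (by simpa using hi) j
      (by simpa using hj) hij))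
  let e : Fin n ≃ V := g.trans (Equiv.subtypeUnivEquiv Finset.mem_univ)
  have he : ∀ i : Fin n, (i : ℕ) ≤ k → e i = p i := fun i hi => hg i (by simpa using hi)
  have hrel : ∀ i j : Fin n, ((j : ℕ) = i + 1 ∧ (j : ℕ) < k) ∨ ((i : ℕ) = k - 1 ∧ k ≤ (j : ℕ)) →
      T.Adj (e i) (e j) := by
    rintro i j (⟨hij, hj⟩ | ⟨hi, hj⟩)
    · rw [he i (by omega), he j (by omega), hij]
      exact hp.adj i (by omega)
    · rw [he i (by omega), hi]
      rcases hj.eq_or_lt with hj | hj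
      · rw [he j (by omega), ← hj]
        have := hp.adj (k - 1) (by omega)
        rwa [Nat.sub_add_cancel hk] at this
      · refine h _ fun l hl hlj => ?_
        rw [← he ⟨l, by omega⟩ hl] at hlj
        have := congrArg Fin.val (e.injective hlj)
        dsimp only at this
        omega
  have hle : (broom n k).map e.toEmbedding ≤ T := by
    rw [map_le_iff_le_comap]
    intro i j hij
    rw [broom_adj] at hij
    rcases hij.2 with hij | hij
    · exact hrel i j hij
    · exact (hrel j i hij).symm
  have hiso := Iso.map e (broom n k)
  have hconn : ((broom n k).map e.toEmbedding).Connected :=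
    hiso.connected_iff.1 (broom_connected hk (by omega))
  rw [← (isTree_iff_minimal_connected.1 hT).eq_of_le hconn hle]
  exact ⟨hiso.symm⟩

theorem IsBroomAlong.nonempty_iso {T : SimpleGraph V} (hT : T.IsTree) {n k : ℕ} (hk : 1 ≤ k)
    (hn : k + 1 ≤ n) (hV : Fintype.card V = n) {p : ℕ → V} (hp : T.IsPathMap k p)
    (h : T.IsBroomAlong k p) : Nonempty (T ≃g broom n k) := by
  rcases h with h | h
  · exact hT.nonempty_iso_broom hk hn hV hp h
  · refine hT.nonempty_iso_broom hk hn hV hp.reverse fun x hx => ?_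
    rw [show k - (k - 1) = 1 by omega]
    refine h x fun i hi hix => hx (k - i) (by omega) ?_
    rwa [show k - (k - i) = i by omega]

theorem IsTree.permQ_broom_le {V : Type*} [Fintype V] {T : SimpleGraph V} (hT : T.IsTree)
    {n k : ℕ} (hk : 2 ≤ k) (hn : k + 1 ≤ n) (hV : Fintype.card V = n) {p : ℕ → V}
    (hp : T.IsPathMap k p) :
    (broom n k).permQ ≤ T.permQ ∧ (T.permQ = (broom n k).permQ → T.IsBroomAlong k p) := by
  induction n, hn using Nat.le_induction generalizing V with
  | base =>
    have hb : T.IsBroomAlong k p := by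
      refine .inl fun x hx => ?_
      obtain ⟨i, hi⟩ := ((Fintype.bijective_iff_injective_and_card _).2
        ⟨hp.injective, by simp [hV]⟩).2 x
      exact absurd hi (hx i (by omega))
    obtain ⟨e⟩ := hb.nonempty_iso hT (by omega) le_rfl hV hp
    exact ⟨(permQ_congr e).ge, fun _ => hb⟩
  | succ n hn ih =>
    obtain ⟨v, u, hv, hu⟩ := hT.exists_leaf_notMem_path hp (by
      by_contra! h
      have := Fintype.card_le_of_surjective (fun i : Fin (k + 1) => p i) fun x => by
        obtain ⟨i, hi, hix⟩ := h x
        exact ⟨⟨i, by omega⟩, hix⟩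
      rw [hV, Fintype.card_fin] at this
      omega)
    have huv : T.Adj u v := ((hu u).2 rfl).symm
    have e := T.isoAddLeaf huv.ne hu
    have hT' := hT.induce_compl_leaf hu
    let q : ℕ → {x | x ≠ v} := fun i => ⟨p (min i k), hv _ (by omega)⟩
    have hqp : ∀ i ≤ k, (q i : V) = p i := fun i hi => by simp [q, hi]
    have hq : (T.induce {x | x ≠ v}).IsPathMap k q :=
      ⟨fun i hi => by
        rw [comap_adj]
        change T.Adj (q i : V) (q (i + 1) : V)
        rw [hqp i (by omega), hqp (i + 1) (by omega)]
        exact hp.adj i hi,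
      fun i hi j hj hij => hp.inj i hi j hj (by rw [← hqp i hi, ← hqp j hj, hij])⟩
    have : Nontrivial {x | x ≠ v} := ⟨q 0, q 1, (hq.adj 0 (by omega)).ne⟩
    have hW : Fintype.card {x | x ≠ v} = n := by
      have := Fintype.card_congr e.toEquiv
      rw [Fintype.card_option, hV] at this
      omega
    obtain ⟨hle, heq⟩ := ih hT' hW hq
    obtain ⟨hdel, hdeleq⟩ :=
      hq.halfPell_le_permQDel hT'.connected.exists_adj_of_nontrivial hk ⟨u, huv.ne⟩
    rw [← permQ_congr e, permQ_addLeaf, permQ_broom_succ hk (by omega)]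
    refine ⟨by linarith, fun h => ?_⟩
    refine IsBroomAlong.of_induce huv hqp hk (heq (by linarith)) ?_
    refine (hdeleq (by linarith)).imp (fun h => ⟨?_, h.2⟩) fun h => ⟨?_, h.2⟩
    · exact congrArg Subtype.val h.1
    · exact congrArg Subtype.val h.1

end SimpleGraph

/-- among trees on `n` vertices with diameter at least `k`, the broom
`B(n,k)` uniquely minimizes the permanent of the Laplacian matrix. -/
theorem permL_ge_broom {V : Type*} [Fintype V] (n k : ℕ) (hk : 2 ≤ k)
    (hn : k + 1 ≤ n) (hV : Fintype.card V = n) (T : SimpleGraph V) (hT : T.IsTree)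
    (hdiam : ∃ u v : V, k ≤ T.dist u v) :
    permL (broom n k) ≤ permL T ∧
    (permL T = permL (broom n k) ↔ Nonempty (T ≃g broom n k)) := by
  obtain ⟨u, v, huv⟩ := hdiam
  obtain ⟨w, hw⟩ := hT.connected.exists_walk_length_eq_dist u v
  have hp := (w.isPath_of_length_eq_dist hw).isPathMap_getVert (huv.trans_eq hw.symm)
  rw [SimpleGraph.permL_eq_permQ hT.colorable_two,
    SimpleGraph.permL_eq_permQ (SimpleGraph.broom_colorable (by omega))]
  obtain ⟨hle, heq⟩ := hT.permQ_broom_le hk hn hV hp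
  exact ⟨hle, fun h => (heq h).nonempty_iso hT (by omega) hn hV hp,
    fun ⟨e⟩ => SimpleGraph.permQ_congr e⟩
end

section
/- Let n and k be integers with k ≥ 2 and n ≥ k+1. Then π(B(n,k)) = [1 + √2 − √2/(2(n−k+1))]·((1+√2)/2)^{k−2} + [1 − √2 + √2/(2(n−k+1))]·((1−√2)/2)^{k−2}. -/
open scoped Classical

/-- Product of the degrees of all vertices of `G`. -/
noncomputable def PD {V : Type*} [Fintype V] (G : SimpleGraph V) : ℝ :=
  ∏ v, (G.degree v : ℝ)

/-- The Laplacian ratio `π(G) = per L(G) / PD(G)`. -/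
noncomputable def lapRatio {V : Type*} [Fintype V] (G : SimpleGraph V) : ℝ :=
  permL G / PD G

/-- The permanent of the principal submatrix of `M` indexed by `S`, written as a sum over the
permutations of the whole index type that fix every point outside `S`. -/
noncomputable def permOn {V : Type*} [Fintype V] [DecidableEq V]
    (M : Matrix V V ℝ) (S : Finset V) : ℝ :=
  ∑ σ : Equiv.Perm V with ∀ x, x ∉ S → σ x = x, ∏ x ∈ S, M x (σ x)

section PermOn

theorem apply_mem_of_fixes_compl {V : Type*} {S : Finset V} {σ : Equiv.Perm V}
    (h : ∀ x, x ∉ S → σ x = x) {x : V} (hx : x ∈ S) : σ x ∈ S := by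
  by_contra hS
  have := σ.injective (h _ hS)
  exact hS (this.symm ▸ hx)

variable {V : Type*} [Fintype V] [DecidableEq V] (M : Matrix V V ℝ)

theorem permOn_univ : permOn M Finset.univ = M.permanent := by
  rw [← Matrix.permanent_transpose]
  simp [permOn, Matrix.permanent]

theorem permOn_empty : permOn M ∅ = 1 := by
  have : (Finset.univ.filter fun σ : Equiv.Perm V => ∀ x, x ∉ (∅ : Finset V) → σ x = x) = {1} := by
    ext σ
    simp [Equiv.ext_iff]
  rw [permOn, this, Finset.sum_singleton, Finset.prod_empty]

theorem sum_fixing_eq_mul_permOn_erase {S : Finset V} {v : V} (hv : v ∈ S) :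
    ∑ σ : Equiv.Perm V with (∀ x, x ∉ S → σ x = x) ∧ σ v = v, ∏ x ∈ S, M x (σ x)
      = M v v * permOn M (S.erase v) := by
  rw [permOn, Finset.mul_sum]
  refine Finset.sum_congr ?_ ?_
  · ext σ
    simp only [Finset.mem_filter, Finset.mem_univ, true_and, Finset.mem_erase, not_and]
    constructor
    · rintro ⟨h, h'⟩ x hx
      by_cases hxv : x = v
      · rw [hxv, h']
      · exact h x (hx hxv)
    · intro h
      exact ⟨fun x hx => h x fun _ => hx, h v fun h => absurd rfl h⟩
  · intro σ hσ
    have h : σ v = v := by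
      simp only [Finset.mem_filter, Finset.mem_univ, true_and, Finset.mem_erase, not_and] at hσ
      exact hσ v fun h => absurd rfl h
    rw [← Finset.mul_prod_erase S _ hv, h]

theorem permOn_eq_add {S : Finset V} {v : V} (hv : v ∈ S) :
    permOn M S = M v v * permOn M (S.erase v) +
      ∑ σ : Equiv.Perm V with (∀ x, x ∉ S → σ x = x) ∧ σ v ≠ v, ∏ x ∈ S, M x (σ x) := by
  rw [← sum_fixing_eq_mul_permOn_erase M hv, ← Finset.filter_filter, ← Finset.filter_filter,
    Finset.sum_filter_add_sum_filter_not]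
  rfl

theorem permOn_of_isolated {S : Finset V} {v : V} (hv : v ∈ S)
    (h : ∀ x ∈ S, x ≠ v → M v x = 0) : permOn M S = M v v * permOn M (S.erase v) := by
  rw [permOn_eq_add M hv, Finset.sum_eq_zero, add_zero]
  intro σ hσ
  simp only [Finset.mem_filter, Finset.mem_univ, true_and] at hσ
  exact Finset.prod_eq_zero hv (h _ (apply_mem_of_fixes_compl hσ.1 hv) hσ.2)

theorem permOn_of_pendant {S : Finset V} {v p : V} (hv : v ∈ S) (hp : p ∈ S) (hpv : p ≠ v)
    (hrow : ∀ x ∈ S, x ≠ v → x ≠ p → M v x = 0) (hcol : ∀ x ∈ S, x ≠ v → x ≠ p → M x v = 0) :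
    permOn M S = M v v * permOn M (S.erase v) +
      M v p * M p v * permOn M ((S.erase v).erase p) := by
  rw [permOn_eq_add M hv]
  congr 1
  have hsub : (Finset.univ.filter fun σ : Equiv.Perm V =>
      (∀ x, x ∉ S → σ x = x) ∧ σ v = p ∧ σ p = v) ⊆
      Finset.univ.filter fun σ : Equiv.Perm V => (∀ x, x ∉ S → σ x = x) ∧ σ v ≠ v := by
    intro σ
    simp only [Finset.mem_filter, Finset.mem_univ, true_and]
    rintro ⟨h, h1, -⟩
    exact ⟨h, h1 ▸ hpv⟩
  rw [← Finset.sum_subset hsub, permOn, Finset.mul_sum]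
  · refine Finset.sum_nbij' (fun σ => Equiv.swap v p * σ) (fun σ => Equiv.swap v p * σ)
      ?_ ?_ ?_ ?_ ?_
    · intro σ
      simp only [Finset.mem_filter, Finset.mem_univ, true_and, Finset.mem_erase, not_and,
        Equiv.Perm.mul_apply]
      rintro ⟨h, h1, h2⟩ x hx
      by_cases hxp : x = p
      · rw [hxp, h2, Equiv.swap_apply_left]
      by_cases hxv : x = v
      · rw [hxv, h1, Equiv.swap_apply_right]
      rw [h x (hx hxp hxv), Equiv.swap_apply_of_ne_of_ne hxv hxp]
    · intro σ
      simp only [Finset.mem_filter, Finset.mem_univ, true_and, Finset.mem_erase, not_and,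
        Equiv.Perm.mul_apply]
      intro h
      have h1 : σ v = v := h v fun _ h => absurd rfl h
      have h2 : σ p = p := h p fun h => absurd rfl h
      refine ⟨fun x hx => ?_, ?_, ?_⟩
      · rw [h x fun _ _ => hx, Equiv.swap_apply_of_ne_of_ne]
        · rintro rfl; exact hx hv
        · rintro rfl; exact hx hp
      · rw [h1, Equiv.swap_apply_left]
      · rw [h2, Equiv.swap_apply_right]
    · intro σ _
      simp
    · intro σ _
      simp
    · intro σ
      simp only [Finset.mem_filter, Finset.mem_univ, true_and]
      rintro ⟨h, h1, h2⟩
      have hp' : p ∈ S.erase v := Finset.mem_erase.2 ⟨hpv, hp⟩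
      rw [← Finset.mul_prod_erase S _ hv, ← Finset.mul_prod_erase (S.erase v) _ hp', h1, h2,
        mul_assoc]
      congr 2
      refine Finset.prod_congr rfl fun x hx => ?_
      simp only [Finset.mem_erase] at hx
      rw [Equiv.Perm.mul_apply, Equiv.swap_apply_of_ne_of_ne]
      · exact fun h' => hx.1 (σ.injective (h'.trans h2.symm))
      · exact fun h' => hx.2.1 (σ.injective (h'.trans h1.symm))
  · intro σ
    simp only [Finset.mem_filter, Finset.mem_univ, true_and, not_and]
    rintro ⟨h, hσv⟩ h'
    by_cases h1 : σ v = p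
    · have h2 := h' h h1
      have hσw : σ (σ.symm v) = v := σ.apply_symm_apply v
      have hw : σ.symm v ∈ S := by
        by_contra hS
        have := h _ hS
        rw [hσw] at this
        exact hS (this ▸ hv)
      refine Finset.prod_eq_zero hw ?_
      rw [hσw]
      refine hcol _ hw (fun e => hσv ?_) (fun e => h2 ?_)
      · rwa [e] at hσw
      · rwa [e] at hσw
    · exact Finset.prod_eq_zero hv (hrow _ (apply_mem_of_fixes_compl h hv) hσv h1)

end PermOn

section Broom

variable {n k : ℕ}

theorem broom_adj (i j : Fin n) : (broom n k).Adj i j ↔ i ≠ j ∧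
    ((((j : ℕ) = (i : ℕ) + 1 ∧ (j : ℕ) < k) ∨ ((i : ℕ) = k - 1 ∧ k ≤ (j : ℕ))) ∨
    (((i : ℕ) = (j : ℕ) + 1 ∧ (i : ℕ) < k) ∨ ((j : ℕ) = k - 1 ∧ k ≤ (i : ℕ)))) := by
  simp [broom, SimpleGraph.fromRel_adj]

theorem lapMatrix_broom_self (i : Fin n) :
    (broom n k).lapMatrix ℝ i i = (broom n k).degree i := by
  simp [SimpleGraph.lapMatrix, SimpleGraph.degMatrix]

theorem lapMatrix_broom_of_adj {i j : Fin n} (h : (broom n k).Adj i j) :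
    (broom n k).lapMatrix ℝ i j = -1 := by
  simp [SimpleGraph.lapMatrix, SimpleGraph.degMatrix, h.ne, h]

theorem lapMatrix_broom_of_not_adj {i j : Fin n} (hij : i ≠ j) (h : ¬ (broom n k).Adj i j) :
    (broom n k).lapMatrix ℝ i j = 0 := by
  simp [SimpleGraph.lapMatrix, SimpleGraph.degMatrix, hij, h]

/-- The degree of vertex `i` of the broom `B(n,k)`. -/
def broomDegree (n k i : ℕ) : ℕ :=
  if i = 0 then 1 else if i < k - 1 then 2 else if i = k - 1 then n - k + 1 else 1

theorem degree_broom (hk : 2 ≤ k) (hn : k + 1 ≤ n) (i : Fin n) :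
    (broom n k).degree i = broomDegree n k i := by
  have hi := i.isLt
  rw [← SimpleGraph.card_neighborFinset_eq_degree, broomDegree]
  split_ifs with h0 h1 h2
  · have : (broom n k).neighborFinset i = {⟨1, by omega⟩} := by
      ext j
      have := j.isLt
      simp only [SimpleGraph.mem_neighborFinset, broom_adj, Finset.mem_singleton, Fin.ext_iff, ne_eq]
      omega
    rw [this, Finset.card_singleton]
  · have : (broom n k).neighborFinset i = {⟨i - 1, by omega⟩, ⟨i + 1, by omega⟩} := by
      ext j
      have := j.isLt
      simp only [SimpleGraph.mem_neighborFinset, broom_adj, Finset.mem_singleton,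
        Finset.mem_insert, Fin.ext_iff, ne_eq]
      omega
    rw [this, Finset.card_pair]
    simp only [ne_eq, Fin.ext_iff]
    omega
  · have : (broom n k).neighborFinset i =
        insert ⟨k - 2, by omega⟩ (Finset.Ici ⟨k, by omega⟩) := by
      ext j
      have := j.isLt
      simp only [SimpleGraph.mem_neighborFinset, broom_adj, Finset.mem_Ici,
        Finset.mem_insert, Fin.ext_iff, ne_eq, Fin.le_def]
      omega
    rw [this, Finset.card_insert_of_notMem, Fin.card_Ici]
    simp only [Finset.mem_Ici, Fin.le_def]
    omega
  · have : (broom n k).neighborFinset i = {⟨k - 1, by omega⟩} := by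
      ext j
      have := j.isLt
      simp only [SimpleGraph.mem_neighborFinset, broom_adj, Finset.mem_singleton, Fin.ext_iff, ne_eq]
      omega
    rw [this, Finset.card_singleton]

theorem PD_broom (hk : 2 ≤ k) (hn : k + 1 ≤ n) :
    PD (broom n k) = 2 ^ (k - 2) * ((n : ℝ) - k + 1) := by
  obtain ⟨K, rfl⟩ := Nat.exists_eq_add_of_le' hk
  obtain ⟨m, rfl⟩ := Nat.exists_eq_add_of_le (Nat.le_of_succ_le hn)
  simp only [PD, degree_broom hk hn]
  rw [Fin.prod_univ_eq_prod_range (fun i => (broomDegree (K + 2 + m) (K + 2) i : ℝ)),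
    Finset.prod_range_add, Finset.prod_range_succ, Finset.prod_range_succ']
  have h1 : ∀ i ∈ Finset.range K, (broomDegree (K + 2 + m) (K + 2) (i + 1) : ℝ) = 2 := by
    intro i hi
    have := Finset.mem_range.1 hi
    rw [broomDegree, if_neg (by omega), if_pos (by omega)]
    norm_num
  have h2 : ∀ i ∈ Finset.range m, (broomDegree (K + 2 + m) (K + 2) (K + 2 + i) : ℝ) = 1 := by
    intro i hi
    rw [broomDegree, if_neg (by omega), if_neg (by omega), if_neg (by omega)]
    norm_num
  rw [Finset.prod_congr rfl h1, Finset.prod_congr rfl h2]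
  simp [broomDegree]

/-- The permanent of the principal submatrix of the Laplacian of `B(n,k)` on the
first `m` vertices. -/
noncomputable def broomPerm (n k m : ℕ) : ℝ :=
  permOn ((broom n k).lapMatrix ℝ) (Finset.univ.filter fun i : Fin n => (i : ℕ) < m)

theorem broomPerm_zero : broomPerm n k 0 = 1 := by
  simp [broomPerm, permOn_empty]

theorem broomPerm_one (hk : 2 ≤ k) (hn : k + 1 ≤ n) : broomPerm n k 1 = 1 := by
  rw [broomPerm, permOn_of_isolated (v := ⟨0, by omega⟩) _ (by simp), lapMatrix_broom_self,
    degree_broom hk hn]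
  · have : (Finset.univ.filter fun i : Fin n => (i : ℕ) < 1).erase ⟨0, by omega⟩ = ∅ := by
      ext j
      simp [Fin.ext_iff]
    rw [this, permOn_empty]
    simp [broomDegree]
  · intro x hx hx0
    simp only [Finset.mem_filter, Finset.mem_univ, true_and, ne_eq, Fin.ext_iff] at hx hx0
    omega

theorem broomPerm_path (hk : 2 ≤ k) (hn : k + 1 ≤ n) {m : ℕ} (hm : m + 2 ≤ k) :
    broomPerm n k (m + 2) =
      broomDegree n k (m + 1) * broomPerm n k (m + 1) + broomPerm n k m := by
  have hadj : (broom n k).Adj ⟨m + 1, by omega⟩ ⟨m, by omega⟩ := by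
    simp only [broom_adj, ne_eq, Fin.ext_iff, true_and]
    omega
  rw [broomPerm, permOn_of_pendant (v := ⟨m + 1, by omega⟩) (p := ⟨m, by omega⟩) _ (by simp)
    (by simp) hadj.ne.symm, lapMatrix_broom_self, degree_broom hk hn,
    lapMatrix_broom_of_adj hadj, lapMatrix_broom_of_adj hadj.symm]
  · have h1 : (Finset.univ.filter fun i : Fin n => (i : ℕ) < m + 2).erase ⟨m + 1, by omega⟩ =
        Finset.univ.filter fun i : Fin n => (i : ℕ) < m + 1 := by
      ext j
      simp only [Finset.mem_erase, Finset.mem_filter, Finset.mem_univ, true_and, ne_eq, Fin.ext_iff]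
      omega
    have h2 : (Finset.univ.filter fun i : Fin n => (i : ℕ) < m + 1).erase ⟨m, by omega⟩ =
        Finset.univ.filter fun i : Fin n => (i : ℕ) < m := by
      ext j
      simp only [Finset.mem_erase, Finset.mem_filter, Finset.mem_univ, true_and, ne_eq, Fin.ext_iff]
      omega
    rw [h1, h2]
    simp [broomPerm]
  · intro x hx hxv hxp
    simp only [Finset.mem_filter, Finset.mem_univ, true_and, ne_eq, Fin.ext_iff] at hx hxv hxp
    apply lapMatrix_broom_of_not_adj
    · simp only [ne_eq, Fin.ext_iff]
      omega
    · simp only [broom_adj, ne_eq, Fin.ext_iff]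
      omega
  · intro x hx hxv hxp
    simp only [Finset.mem_filter, Finset.mem_univ, true_and, ne_eq, Fin.ext_iff] at hx hxv hxp
    apply lapMatrix_broom_of_not_adj
    · simp only [ne_eq, Fin.ext_iff]
      omega
    · simp only [broom_adj, ne_eq, Fin.ext_iff]
      omega

/-- Deleting the centre of a broom leaves a path and isolated vertices. -/
theorem permOn_broom_erase_center (hk : 2 ≤ k) (hn : k + 1 ≤ n) (m : ℕ) (hm : k + m ≤ n) :
    permOn ((broom n k).lapMatrix ℝ)
      ((Finset.univ.filter fun i : Fin n => (i : ℕ) < k + m).erase ⟨k - 1, by omega⟩) =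
      broomPerm n k (k - 1) := by
  induction m with
  | zero =>
    rw [broomPerm]
    congr 1
    ext j
    simp only [Finset.mem_erase, Finset.mem_filter, Finset.mem_univ, true_and, ne_eq, Fin.ext_iff]
    omega
  | succ m ih =>
    rw [← ih (by omega), permOn_of_isolated (v := ⟨k + m, by omega⟩), lapMatrix_broom_self,
      degree_broom hk hn, broomDegree, if_neg (by simp only; omega), if_neg (by simp only; omega),
      if_neg (by simp only; omega), Nat.cast_one, one_mul]
    · congr 1
      ext j
      simp only [Finset.mem_erase, Finset.mem_filter, Finset.mem_univ, true_and, ne_eq,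
        Fin.ext_iff]
      omega
    · simp only [Finset.mem_erase, Finset.mem_filter, Finset.mem_univ, true_and, ne_eq,
        Fin.ext_iff]
      omega
    · intro x hx hxv
      simp only [Finset.mem_erase, Finset.mem_filter, Finset.mem_univ, true_and, ne_eq,
        Fin.ext_iff] at hx hxv
      apply lapMatrix_broom_of_not_adj
      · simp only [ne_eq, Fin.ext_iff]
        omega
      · simp only [broom_adj, ne_eq, Fin.ext_iff]
        omega

theorem broomPerm_add_leaves (hk : 2 ≤ k) (hn : k + 1 ≤ n) (m : ℕ) (hm : k + m ≤ n) :
    broomPerm n k (k + m) = broomPerm n k k + m * broomPerm n k (k - 1) := by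
  induction m with
  | zero => simp
  | succ m ih =>
    have hadj : (broom n k).Adj ⟨k + m, by omega⟩ ⟨k - 1, by omega⟩ := by
      simp only [broom_adj, ne_eq, Fin.ext_iff, true_and]
      omega
    have hrest : (Finset.univ.filter fun i : Fin n => (i : ℕ) < k + (m + 1)).erase
        ⟨k + m, by omega⟩ = Finset.univ.filter fun i : Fin n => (i : ℕ) < k + m := by
      ext j
      simp only [Finset.mem_erase, Finset.mem_filter, Finset.mem_univ, true_and, ne_eq,
        Fin.ext_iff]
      omega
    have hnonadj : ∀ x : Fin n, x ≠ ⟨k + m, by omega⟩ → x ≠ ⟨k - 1, by omega⟩ →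
        ¬ (broom n k).Adj ⟨k + m, by omega⟩ x := by
      intro x hxv hxp
      simp only [broom_adj, ne_eq, Fin.ext_iff] at hxv hxp ⊢
      omega
    rw [broomPerm, permOn_of_pendant (v := ⟨k + m, by omega⟩) (p := ⟨k - 1, by omega⟩) _ (by simp)
      (by simp only [Finset.mem_filter, Finset.mem_univ, true_and]; omega) hadj.ne.symm
      (fun x _ hxv hxp => lapMatrix_broom_of_not_adj hxv.symm (hnonadj x hxv hxp))
      (fun x _ hxv hxp => lapMatrix_broom_of_not_adj hxv fun h => hnonadj x hxv hxp h.symm),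
      hrest, permOn_broom_erase_center hk hn m (by omega), lapMatrix_broom_self,
      degree_broom hk hn, lapMatrix_broom_of_adj hadj, lapMatrix_broom_of_adj hadj.symm,
      broomDegree, if_neg (by simp only; omega), if_neg (by simp only; omega),
      if_neg (by simp only; omega)]
    have := ih (by omega)
    rw [broomPerm] at this
    rw [this]
    push_cast
    ring

theorem broomPerm_of_lt (hk : 2 ≤ k) (hn : k + 1 ≤ n) (m : ℕ) (hm : m < k) :
    broomPerm n k m = ((1 + Real.sqrt 2) ^ m + (1 - Real.sqrt 2) ^ m) / 2 := by
  induction m using Nat.twoStepInduction with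
  | zero => rw [broomPerm_zero]; norm_num
  | one => rw [broomPerm_one hk hn]; ring
  | more m ih1 ih2 =>
    rw [broomPerm_path hk hn hm.le, ih1 (by omega), ih2 (by omega), broomDegree,
      if_neg (by omega), if_pos (by omega)]
    have h2 : Real.sqrt 2 ^ 2 = 2 := Real.sq_sqrt (by norm_num)
    push_cast
    linear_combination (-((1 + Real.sqrt 2) ^ m + (1 - Real.sqrt 2) ^ m) / 2) * h2

theorem permL_broom (hk : 2 ≤ k) (hn : k + 1 ≤ n) :
    permL (broom n k) =
      (2 * ((n : ℝ) - k) + 1) * broomPerm n k (k - 1) + broomPerm n k (k - 2) := by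
  have h : permL (broom n k) = broomPerm n k (k + (n - k)) := by
    have huniv : (Finset.univ.filter fun i : Fin n => (i : ℕ) < k + (n - k)) = Finset.univ := by
      ext j
      have := j.isLt
      simp only [Finset.mem_filter, Finset.mem_univ, true_and, iff_true]
      omega
    rw [broomPerm, huniv, permOn_univ, permL]
    congr!
  have hpath := broomPerm_path hk hn (m := k - 2) (by omega)
  rw [show k - 2 + 2 = k by omega, show k - 2 + 1 = k - 1 by omega, broomDegree,
    if_neg (by omega), if_neg (by omega), if_pos rfl] at hpath
  rw [h, broomPerm_add_leaves hk hn _ (by omega), hpath]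
  push_cast [Nat.cast_sub (show k ≤ n by omega)]
  ring

end Broom

/-- the closed formula for the Laplacian ratio of the broom `B(n,k)`. -/
theorem lapRatio_broom_eq (n k : ℕ) (hk : 2 ≤ k) (hn : k + 1 ≤ n) :
    lapRatio (broom n k)
      = (1 + Real.sqrt 2 - Real.sqrt 2 / (2 * ((n : ℝ) - (k : ℝ) + 1))) *
          ((1 + Real.sqrt 2) / 2) ^ (k - 2) +
        (1 - Real.sqrt 2 + Real.sqrt 2 / (2 * ((n : ℝ) - (k : ℝ) + 1))) *
          ((1 - Real.sqrt 2) / 2) ^ (k - 2) := by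
  have hpos : (0 : ℝ) < (n : ℝ) - k + 1 := by
    have : (k : ℝ) + 1 ≤ n := by exact_mod_cast hn
    linarith
  rw [lapRatio, permL_broom hk hn, PD_broom hk hn, broomPerm_of_lt hk hn _ (by omega),
    broomPerm_of_lt hk hn _ (by omega), show k - 1 = (k - 2) + 1 by omega, div_pow, div_pow]
  have hne := hpos.ne'
  field_simp
  ring
end

section
/- Let T be a tree with at least 2 vertices and let v be a vertex of T with degree d(v). Then per L(T) > (d(v) − 1)·per L_v(T). -/
open scoped Classical

/-- Permanent of the principal submatrix of the Laplacian of `G` obtained by deleting the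
rows and columns indexed by vertices in `S`. -/
noncomputable def permDel {V : Type*} [Fintype V] (G : SimpleGraph V) (S : Set V) : ℝ :=
  ((G.lapMatrix ℝ).submatrix (fun i : ↥(Sᶜ) => (i : V)) (fun i : ↥(Sᶜ) => (i : V))).permanent

theorem SimpleGraph.lapMatrix_apply_self {V : Type*} [Fintype V] (G : SimpleGraph V) (v : V) :
    G.lapMatrix ℝ v v = G.degree v := by
  simp [SimpleGraph.lapMatrix, SimpleGraph.degMatrix]

/-- For a bipartite graph, every term of the permanent of a submatrix of the Laplacian is
nonnegative: conjugating by the signs of a 2-colouring makes all entries nonnegative. -/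
theorem SimpleGraph.IsBipartite.prod_lapMatrix_nonneg {V W : Type*} [Fintype V] [Fintype W]
    {G : SimpleGraph V} (hG : G.IsBipartite) (f : W → V) (σ : Equiv.Perm W) :
    0 ≤ ∏ i, G.lapMatrix ℝ (f (σ i)) (f i) := by
  obtain ⟨c⟩ := hG
  set ε : V → ℝ := fun v => (-1) ^ (c v : ℕ) with hε
  have hsq (v : V) : ε v * ε v = 1 := by
    rw [hε, ← mul_pow]; norm_num
  have hprod : ∏ i, G.lapMatrix ℝ (f (σ i)) (f i)
      = ∏ i, ε (f (σ i)) * ε (f i) * G.lapMatrix ℝ (f (σ i)) (f i) := by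
    rw [Finset.prod_mul_distrib, Finset.prod_mul_distrib,
      Equiv.prod_comp σ (fun i => ε (f i)), ← Finset.prod_mul_distrib]
    simp [hsq]
  rw [hprod]
  refine Finset.prod_nonneg fun i _ => ?_
  generalize f (σ i) = a, f i = b
  by_cases hab : a = b
  · subst hab
    rw [hsq, one_mul, G.lapMatrix_apply_self]
    positivity
  by_cases hadj : G.Adj a b
  · have hne := c.valid hadj
    have hval : ε a * ε b = -1 := by
      simp only [hε]
      generalize c a = x, c b = y at hne ⊢
      fin_cases x <;> fin_cases y <;> simp_all
    simp [hval, SimpleGraph.lapMatrix, SimpleGraph.degMatrix, hab, hadj]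
  · simp [SimpleGraph.lapMatrix, SimpleGraph.degMatrix, hab, hadj]

theorem SimpleGraph.IsBipartite.permDel_pos {V : Type*} [Fintype V] {G : SimpleGraph V}
    (hG : G.IsBipartite) (hdeg : ∀ v, 0 < G.degree v) (S : Set V) : 0 < permDel G S := by
  refine Finset.sum_pos' (fun σ _ => hG.prod_lapMatrix_nonneg _ σ) ⟨1, Finset.mem_univ _, ?_⟩
  refine Finset.prod_pos fun i _ => ?_
  simpa [G.lapMatrix_apply_self] using hdeg i

theorem SimpleGraph.IsBipartite.degree_mul_permDel_le_permL {V : Type*} [Fintype V]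
    {G : SimpleGraph V} (hG : G.IsBipartite) (v : V) :
    (G.degree v : ℝ) * permDel G {v} ≤ permL G := by
  have hterm (σ : Equiv.Perm ↥({v}ᶜ : Set V)) :
      (G.degree v : ℝ) * ∏ i, G.lapMatrix ℝ (σ i) i
        = ∏ i, G.lapMatrix ℝ (Equiv.Perm.ofSubtype σ i) i := by
    rw [← Fintype.prod_subtype_mul_prod_subtype (· ∈ ({v}ᶜ : Set V)), mul_comm]
    congr 1
    · simp
    · have hfix (i : {x // ¬ x ∈ ({v}ᶜ : Set V)}) :
          G.lapMatrix ℝ (Equiv.Perm.ofSubtype σ i) i = G.degree v := by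
        have hi : (i : V) = v := by simpa using i.2
        rw [Equiv.Perm.ofSubtype_apply_of_not_mem σ i.2, hi, G.lapMatrix_apply_self]
      simp [hfix]
  calc (G.degree v : ℝ) * permDel G {v}
      = ∑ σ : Equiv.Perm ↥({v}ᶜ : Set V),
          ∏ i, G.lapMatrix ℝ (Equiv.Perm.ofSubtype σ i) i := by
        simp only [← hterm, ← Finset.mul_sum]
        rfl
    _ = ∑ τ ∈ Finset.univ.map ⟨_, Equiv.Perm.ofSubtype_injective (p := (· ∈ ({v}ᶜ : Set V)))⟩,
          ∏ i, G.lapMatrix ℝ (τ i) i := by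
        simp only [Finset.sum_map]
        rfl
    _ ≤ permL G :=
        Finset.sum_le_sum_of_subset_of_nonneg (Finset.subset_univ _)
          fun τ _ _ => hG.prod_lapMatrix_nonneg id τ

/-- for a tree `T` with at least 2 vertices and a vertex `v`,
`per L(T) > (d(v) − 1)·per L_v(T)`. -/
theorem permL_gt_degree_sub_one_mul_permDel {V : Type*} [Fintype V] (T : SimpleGraph V)
    (hT : T.IsTree) (hcard : 2 ≤ Fintype.card V) (v : V) :
    ((T.degree v : ℝ) - 1) * permDel T {v} < permL T := by
  have : Nontrivial V := Fintype.one_lt_card_iff_nontrivial.mp hcard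
  have hle := hT.isBipartite.degree_mul_permDel_le_permL v
  have hpos := hT.isBipartite.permDel_pos
    (fun w => hT.connected.preconnected.degree_pos_of_nontrivial w) {v}
  linarith
end
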